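/- The restriction of the newform Dedekind sum S_{χ₁,χ₂} to Γ₁(q₁q₂) is a group homomorphism into the additive group of ℂ: for all γ₁, γ₂ ∈ Γ₁(q₁q₂), S_{χ₁,χ₂}(γ₁γ₂) = S_{χ₁,χ₂}(γ₁) + S_{χ₁,χ₂}(γ₂). -/

import Mathlib

open Complex Finset
open scoped Classical

/-- The sawtooth function `B₁(x)`: `0` if `x ∈ ℤ`, and `x - ⌊x⌋ - 1/2` otherwise. -/
noncomputable def sawtooth (x : ℝ) : ℝ :=
  if ∃ n : ℤ, (n : ℝ) = x then 0 else Int.fract x - 1 / 2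

/-- The newform Dedekind sum `S_{χ₁,χ₂}(a, c)` associated to Dirichlet characters
`χ₁ mod q₁` and `χ₂ mod q₂`. -/
noncomputable def newformDedekindSum {q₁ q₂ : ℕ} (χ₁ : DirichletCharacter ℂ q₁)
    (χ₂ : DirichletCharacter ℂ q₂) (a c : ℤ) : ℂ :=
  ∑ j ∈ Finset.range c.toNat, ∑ n ∈ Finset.range q₁,
    (starRingEnd ℂ) (χ₂ (j : ZMod q₂)) * (starRingEnd ℂ) (χ₁ (n : ZMod q₁)) *
      (sawtooth ((j : ℝ) / (c : ℝ)) : ℂ) *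
      (sawtooth ((n : ℝ) / (q₁ : ℝ) + (a : ℝ) * (j : ℝ) / (c : ℝ)) : ℂ)

/-- The newform Dedekind sum of a matrix `γ = (a, b; c, d) ∈ SL₂(ℤ)`:
it is `S_{χ₁,χ₂}(a, c)` if `c ≥ 1`, `S_{χ₁,χ₂}(-γ)` if `c ≤ -1`, and `0` if `c = 0`. -/
noncomputable def newformDedekindSumSL {q₁ q₂ : ℕ} (χ₁ : DirichletCharacter ℂ q₁)
    (χ₂ : DirichletCharacter ℂ q₂) (γ : Matrix.SpecialLinearGroup (Fin 2) ℤ) : ℂ :=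
  if γ.1 1 0 = 0 then 0
  else if 1 ≤ γ.1 1 0 then newformDedekindSum χ₁ χ₂ (γ.1 0 0) (γ.1 1 0)
  else newformDedekindSum χ₁ χ₂ (-(γ.1 0 0)) (-(γ.1 1 0))

/-- Membership in `Γ₀(N)`: the lower-left entry is divisible by `N`. -/
def InGamma0 (N : ℕ) (γ : Matrix.SpecialLinearGroup (Fin 2) ℤ) : Prop :=
  (N : ℤ) ∣ γ.1 1 0

/-- Membership in `Γ₁(N)`: lower-left entry divisible by `N` and both diagonal
entries congruent to `1` mod `N`. -/
def InGamma1 (N : ℕ) (γ : Matrix.SpecialLinearGroup (Fin 2) ℤ) : Prop :=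
  InGamma0 N γ ∧ (N : ℤ) ∣ (γ.1 0 0 - 1) ∧ (N : ℤ) ∣ (γ.1 1 1 - 1)

/-- `x` lies in the ring of integers `ℤ[χ₁,χ₂]` of the field `F_{χ₁,χ₂} ⊆ ℂ` generated
by the values of `χ₁` and `χ₂`: `x` lies in the subfield of `ℂ` generated by the values
of the characters and is integral over `ℤ`. -/
def InRingOfIntegers {q₁ q₂ : ℕ} (χ₁ : DirichletCharacter ℂ q₁)
    (χ₂ : DirichletCharacter ℂ q₂) (x : ℂ) : Prop :=
  x ∈ Subfield.closure (Set.range (χ₁ : ZMod q₁ → ℂ) ∪ Set.range (χ₂ : ZMod q₂ → ℂ)) ∧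
    IsIntegral ℤ x

lemma sum_range_periodic {c : ℕ} {g : ℝ → ℝ} (hg : Function.Periodic g c) :
    Function.Periodic (fun x => ∑ k ∈ range c, g (x + k)) 1 := by
  intro x
  have h1 := Finset.sum_range_succ (fun k : ℕ => g (x + k)) c
  have h2 := Finset.sum_range_succ' (fun k : ℕ => g (x + k)) c
  have h3 : ∀ k : ℕ, g (x + ((k + 1 : ℕ) : ℝ)) = g (x + 1 + k) := fun k => by
    congr 1; push_cast; ring
  simp only [h3, Nat.cast_zero, add_zero, hg x] at h1 h2
  simpa using h2.symm.trans h1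

lemma sum_range_reflect_periodic {c : ℕ} {g : ℝ → ℝ} (hg : Function.Periodic g c) (x : ℝ) :
    ∑ k ∈ range c, g (-(x + k)) = ∑ k ∈ range c, g (-x + k) := by
  have h := sum_range_periodic hg (-x)
  beta_reduce at h
  rw [← h, ← Finset.sum_range_reflect]
  refine Finset.sum_congr rfl fun k hk => ?_
  have hk' := Finset.mem_range.1 hk
  rw [← hg (-(x + ((c - 1 - k : ℕ) : ℝ))), Nat.sub_sub, Nat.cast_sub (by omega)]
  congr 1; push_cast; ring

lemma sum_range_mul_coprime {c : ℕ} (hc : 0 < c) {d : ℤ} (hd : IsCoprime d c) {h : ℤ → ℝ}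
    (hh : Function.Periodic h c) : ∑ k ∈ range c, h (d * k) = ∑ k ∈ range c, h k := by
  have : NeZero c := ⟨hc.ne'⟩
  have hmod : ∀ k l : ℤ, k % c = l % c → h k = h l := fun k l hkl => by
    have e : ∀ m : ℤ, h m = h (m % c) := fun m => by
      conv_lhs => rw [← Int.emod_add_mul_ediv m c, mul_comm]
      simpa using hh.int_mul (m / c) (m % c)
    rw [e k, e l, hkl]
  have hu : IsUnit (d : ZMod c) := by
    obtain ⟨a, b, hab⟩ := hd
    refine IsUnit.of_mul_eq_one (a : ZMod c) ?_
    have := congrArg (Int.cast : ℤ → ZMod c) hab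
    push_cast at this
    simpa [mul_comm] using this
  have hz : ∀ f : ℤ → ℝ, ∑ k ∈ range c, f k = ∑ z : ZMod c, f z.val := fun f =>
    Finset.sum_bij' (fun k _ => (k : ZMod c)) (fun z _ => z.val) (by simp)
      (fun z _ => Finset.mem_range.2 z.val_lt)
      (fun k hk => ZMod.val_cast_of_lt (Finset.mem_range.1 hk)) (by simp)
      (fun k hk => by rw [ZMod.val_cast_of_lt (Finset.mem_range.1 hk)])
  rw [hz (fun k => h (d * k)), hz h]
  refine Fintype.sum_equiv (Units.mulLeft hu.unit) _ _ fun z => hmod _ _ ?_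
  refine (ZMod.intCast_eq_intCast_iff' _ _ c).1 ?_
  simp

lemma sawtooth_eq_fract (x : ℝ) : sawtooth x = (Int.fract x - Int.fract (-x)) / 2 := by
  unfold sawtooth
  split_ifs with h
  · obtain ⟨n, rfl⟩ := h
    rw [← Int.cast_neg, Int.fract_intCast, Int.fract_intCast]; simp
  · rw [Int.fract_neg]
    · ring
    · intro h0
      exact h ⟨⌊x⌋, by linarith [Int.floor_add_fract x]⟩

lemma sawtooth_neg (x : ℝ) : sawtooth (-x) = -sawtooth x := by
  simp only [sawtooth_eq_fract, neg_neg]; ring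

lemma sawtooth_periodic : Function.Periodic sawtooth 1 := fun x => by
  simp only [sawtooth_eq_fract, neg_add, Int.fract_add_one]
  rw [← sub_eq_add_neg, Int.fract_sub_one]

lemma sawtooth_add_intCast (x : ℝ) (n : ℤ) : sawtooth (x + n) = sawtooth x := by
  simpa using sawtooth_periodic.int_mul n x

/-- The periodic second Bernoulli function. -/
noncomputable def periodicBernoulliTwo (x : ℝ) : ℝ := Int.fract x ^ 2 - Int.fract x + 1 / 6

lemma periodicBernoulliTwo_periodic : Function.Periodic periodicBernoulliTwo 1 := fun x => by
  simp [periodicBernoulliTwo]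

lemma periodicBernoulliTwo_add_intCast (x : ℝ) (n : ℤ) :
    periodicBernoulliTwo (x + n) = periodicBernoulliTwo x := by
  simp [periodicBernoulliTwo]

lemma periodicBernoulliTwo_neg (x : ℝ) :
    periodicBernoulliTwo (-x) = periodicBernoulliTwo x := by
  unfold periodicBernoulliTwo
  by_cases h : Int.fract x = 0
  · rw [h, Int.fract_neg_eq_zero.2 h]
  · rw [Int.fract_neg h]; ring

lemma Function.Periodic.comp_div {f : ℝ → ℝ} (hf : Function.Periodic f 1) {n : ℕ} (hn : 0 < n) :
    Function.Periodic (fun x => f (x / n)) n := fun x => by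
  have : (n : ℝ) ≠ 0 := by positivity
  simp only [add_div, div_self this, hf (x / n)]

lemma sum_fract_add_div {n : ℕ} (hn : 0 < n) (F : ℝ → ℝ) (x : ℝ) :
    ∑ k ∈ range n, F (Int.fract ((x + k) / n)) =
      ∑ k ∈ range n, F ((Int.fract x + k) / n) := by
  have hn' : (0 : ℝ) < n := by positivity
  have hp : Function.Periodic (fun x : ℝ => F (Int.fract (x / n))) n :=
    Function.Periodic.comp_div (f := fun x => F (Int.fract x)) (fun x => by simp) hn
  have h := (sum_range_periodic hp).sub_int_mul_eq ⌊x⌋ (x := x)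
  simp only [mul_one, Int.self_sub_floor] at h
  rw [← h]
  refine Finset.sum_congr rfl fun k hk => ?_
  have hk' : (k : ℝ) + 1 ≤ n := by exact_mod_cast Finset.mem_range.1 hk
  congr 1
  rw [Int.fract_eq_self]
  have h0 := Int.fract_nonneg x
  have h1 := Int.fract_lt_one x
  exact ⟨by positivity, by rw [div_lt_one hn']; linarith⟩

lemma sum_range_cast (n : ℕ) : ∑ k ∈ range n, (k : ℝ) = n * (n - 1) / 2 := by
  induction n with
  | zero => simp
  | succ n ih => rw [Finset.sum_range_succ, ih]; push_cast; ring

lemma sum_range_cast_sq (n : ℕ) :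
    ∑ k ∈ range n, (k : ℝ) ^ 2 = n * (n - 1) * (2 * n - 1) / 6 := by
  induction n with
  | zero => simp
  | succ n ih => rw [Finset.sum_range_succ, ih]; push_cast; ring

lemma sum_fract_distribution {n : ℕ} (hn : 0 < n) (x : ℝ) :
    ∑ k ∈ range n, Int.fract ((x + k) / n) = Int.fract x + (n - 1) / 2 := by
  have hn' : (n : ℝ) ≠ 0 := by positivity
  rw [sum_fract_add_div hn (fun t => t), ← Finset.sum_div, Finset.sum_add_distrib,
    sum_range_cast]
  simp only [Finset.sum_const, Finset.card_range, nsmul_eq_mul]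
  field_simp

lemma sum_sawtooth_distribution {n : ℕ} (hn : 0 < n) (x : ℝ) :
    ∑ k ∈ range n, sawtooth ((x + k) / n) = sawtooth x := by
  have hp : Function.Periodic (fun x : ℝ => Int.fract (x / n)) n :=
    Function.Periodic.comp_div (fun x => by simp) hn
  have h := sum_range_reflect_periodic hp x
  simp only [neg_div] at h
  simp only [sawtooth_eq_fract]
  rw [← Finset.sum_div, Finset.sum_sub_distrib, h, sum_fract_distribution hn,
    sum_fract_distribution hn]
  ring

lemma sum_periodicBernoulliTwo_distribution {n : ℕ} (hn : 0 < n) (x : ℝ) :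
    ∑ k ∈ range n, periodicBernoulliTwo ((x + k) / n) = periodicBernoulliTwo x / n := by
  have hn' : (n : ℝ) ≠ 0 := by positivity
  unfold periodicBernoulliTwo
  rw [sum_fract_add_div hn (fun t => t ^ 2 - t + 1 / 6)]
  have e : ∀ k : ℕ, ((Int.fract x + k) / n) ^ 2 - (Int.fract x + k) / n + 1 / 6 =
      (k : ℝ) ^ 2 * (1 / n ^ 2) + k * (2 * Int.fract x / n ^ 2 - 1 / n) +
        (Int.fract x ^ 2 / n ^ 2 - Int.fract x / n + 1 / 6) := fun k => by
    field_simp; ring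
  simp only [e, Finset.sum_add_distrib, ← Finset.sum_mul, sum_range_cast, sum_range_cast_sq,
    Finset.sum_const, Finset.card_range, nsmul_eq_mul]
  field_simp
  ring

lemma sawtooth_mul_add {u w : ℝ} (h : ¬((∃ n : ℤ, (n : ℝ) = u) ∧ ∃ n : ℤ, (n : ℝ) = w)) :
    sawtooth u * sawtooth (u + w) + sawtooth w * sawtooth (w + u) =
      sawtooth u * sawtooth w + (periodicBernoulliTwo u + periodicBernoulliTwo w +
        periodicBernoulliTwo (u + w)) / 2 := by
  have hint : ∀ t : ℝ, (∃ n : ℤ, (n : ℝ) = t) ↔ Int.fract t = 0 := fun t =>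
    Int.fract_eq_zero_iff.symm
  have hsum : ∃ m : ℤ, (m = 0 ∨ m = 1) ∧ Int.fract (u + w) = Int.fract u + Int.fract w - m := by
    have hu := Int.fract_nonneg u
    have hw := Int.fract_nonneg w
    have hu1 := Int.fract_lt_one u
    have hw1 := Int.fract_lt_one w
    by_cases hlt : Int.fract u + Int.fract w < 1
    · refine ⟨0, Or.inl rfl, ?_⟩
      rw [Int.fract_eq_iff]
      refine ⟨by push_cast; linarith, by push_cast; linarith, ⌊u⌋ + ⌊w⌋, ?_⟩
      simp only [Int.fract]; push_cast; ring
    · refine ⟨1, Or.inr rfl, ?_⟩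
      rw [Int.fract_eq_iff]
      refine ⟨by push_cast; linarith, by push_cast; linarith, ⌊u⌋ + ⌊w⌋ + 1, ?_⟩
      simp only [Int.fract]; push_cast; ring
  obtain ⟨m, hm, hs⟩ := hsum
  have hu := Int.fract_nonneg u
  have hw := Int.fract_nonneg w
  have hu1 := Int.fract_lt_one u
  have hw1 := Int.fract_lt_one w
  have hs0 := Int.fract_nonneg (u + w)
  have hs1 := Int.fract_lt_one (u + w)
  rw [add_comm w u]
  unfold sawtooth periodicBernoulliTwo
  rw [hint, hint] at h
  simp only [hint]
  rw [hs] at hs0 hs1 ⊢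
  generalize Int.fract u = p at *
  generalize Int.fract w = q at *
  rcases hm with rfl | rfl
  · by_cases hp : p = 0 <;> by_cases hq : q = 0
    · exact absurd ⟨hp, hq⟩ h
    · subst hp; simp [hq]; ring
    · subst hq; simp [hp]; ring
    · have : p + q ≠ 0 := by
        intro h'; exact hp (by linarith)
      simp [hp, hq, this]; ring
  · push_cast at *
    have hp : p ≠ 0 := by rintro rfl; linarith
    have hq : q ≠ 0 := by rintro rfl; linarith
    by_cases hpq : p + q - 1 = 0
    · have : q = 1 - p := by linarith
      subst this
      simp only [if_neg hp, if_neg hq, if_pos hpq]; ring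
    · simp only [if_neg hp, if_neg hq, if_neg hpq]; ring

/-- The Dedekind–Rademacher sum of `d / c` with shifts `x` and `y`. -/
noncomputable def dedekindRademacherSum (c : ℕ) (d : ℤ) (x y : ℝ) : ℝ :=
  ∑ j ∈ range c, sawtooth ((j + y) / c) * sawtooth (x + d * ((j + y) / c))

lemma dedekindRademacherSum_summand_periodic {c : ℕ} (hc : 0 < c) (d : ℤ) (x : ℝ) :
    Function.Periodic (fun t : ℝ => sawtooth (t / c) * sawtooth (x + d * (t / c))) c :=
  Function.Periodic.comp_div (f := fun t => sawtooth t * sawtooth (x + d * t)) (fun t => by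
    simp only [sawtooth_periodic t]
    rw [mul_add, mul_one, ← add_assoc, sawtooth_add_intCast]) hc

lemma dedekindRademacherSum_eq (c : ℕ) (d : ℤ) (x y : ℝ) :
    dedekindRademacherSum c d x y =
      ∑ j ∈ range c, sawtooth ((y + j) / c) * sawtooth (x + d * ((y + j) / c)) := by
  simp only [dedekindRademacherSum, add_comm y]

lemma dedekindRademacherSum_add_intCast (c : ℕ) (d : ℤ) (x y : ℝ) (m n : ℤ) :
    dedekindRademacherSum c d (x + m) (y + n) = dedekindRademacherSum c d x y := by
  rcases Nat.eq_zero_or_pos c with rfl | hc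
  · simp [dedekindRademacherSum]
  have h1 : dedekindRademacherSum c d x (y + n) = dedekindRademacherSum c d x y := by
    simpa only [dedekindRademacherSum_eq, mul_one] using
      (sum_range_periodic (dedekindRademacherSum_summand_periodic hc d x)).int_mul n y
  rw [← h1]
  simp only [dedekindRademacherSum, add_right_comm x (m : ℝ), sawtooth_add_intCast]

lemma dedekindRademacherSum_neg (c : ℕ) (d : ℤ) (x y : ℝ) :
    dedekindRademacherSum c d (-x) (-y) = dedekindRademacherSum c d x y := by
  rcases Nat.eq_zero_or_pos c with rfl | hc
  · simp [dedekindRademacherSum]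
  have h := sum_range_reflect_periodic (dedekindRademacherSum_summand_periodic hc d (-x)) y
  rw [dedekindRademacherSum_eq, ← h, dedekindRademacherSum_eq]
  refine Finset.sum_congr rfl fun k _ => ?_
  rw [neg_div, mul_neg, ← neg_add, sawtooth_neg, sawtooth_neg, neg_mul_neg]

lemma dedekindRademacherSum_neg_left (c : ℕ) (d : ℤ) (x y : ℝ) :
    dedekindRademacherSum c (-d) (-x) y = -dedekindRademacherSum c d x y := by
  unfold dedekindRademacherSum
  rw [← Finset.sum_neg_distrib]
  refine Finset.sum_congr rfl fun k _ => ?_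
  rw [Int.cast_neg, neg_mul, ← neg_add, sawtooth_neg, mul_neg]

lemma dedekindRademacherSum_neg_right (c : ℕ) (d : ℤ) (x y : ℝ) :
    dedekindRademacherSum c (-d) x (-y) = -dedekindRademacherSum c d x y := by
  rw [← dedekindRademacherSum_neg_left, ← dedekindRademacherSum_neg, neg_neg]

lemma dedekindRademacherSum_add (c : ℕ) (d e : ℤ) (x y : ℝ) :
    dedekindRademacherSum c (d + e * c) x y = dedekindRademacherSum c d (x + e * y) y := by
  rcases Nat.eq_zero_or_pos c with rfl | hc
  · simp [dedekindRademacherSum]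
  have hc' : (c : ℝ) ≠ 0 := by positivity
  refine Finset.sum_congr rfl fun k _ => ?_
  rw [← sawtooth_add_intCast (x + e * y + _) (e * k)]
  congr 2
  push_cast
  field_simp
  ring

lemma dedekindRademacherSum_one_zero (x y : ℝ) :
    dedekindRademacherSum 1 0 x y = sawtooth y * sawtooth x := by
  simp [dedekindRademacherSum]

lemma dedekindRademacherSum_eq_sum_sum (c : ℕ) {d : ℕ} (hd : 0 < d) (x y : ℝ) :
    dedekindRademacherSum c d x y = ∑ j ∈ range c, ∑ k ∈ range d,
      sawtooth ((j + y) / c) * sawtooth ((j + y) / c + (k + x) / d) := by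
  have hd' : (d : ℝ) ≠ 0 := by positivity
  refine Finset.sum_congr rfl fun j _ => ?_
  rw [← Finset.mul_sum, ← sum_sawtooth_distribution hd (x + _)]
  congr 1
  refine Finset.sum_congr rfl fun k _ => ?_
  congr 1
  push_cast
  field_simp
  ring

lemma sum_sum_periodicBernoulliTwo {c d : ℕ} (hc : 0 < c) (hd : 0 < d)
    (hcd : IsCoprime (d : ℤ) c) (x y : ℝ) :
    ∑ j ∈ range c, ∑ k ∈ range d, periodicBernoulliTwo ((j + y) / c + (k + x) / d) =
      periodicBernoulliTwo (c * x + d * y) / (c * d) := by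
  have hd' : (d : ℝ) ≠ 0 := by positivity
  have hc' : (c : ℝ) ≠ 0 := by positivity
  have h1 : ∀ j : ℕ, ∑ k ∈ range d, periodicBernoulliTwo ((j + y) / c + (k + x) / d) =
      periodicBernoulliTwo ((c * x + d * y + ((d * j : ℤ) : ℝ)) / c) / d := fun j => by
    rw [← sum_periodicBernoulliTwo_distribution hd]
    refine Finset.sum_congr rfl fun k _ => ?_
    congr 1
    push_cast
    field_simp
    ring
  have hper : Function.Periodic
      (fun k : ℤ => periodicBernoulliTwo ((c * x + d * y + (k : ℝ)) / c)) c := fun k => by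
    have := Function.Periodic.comp_div periodicBernoulliTwo_periodic hc (c * x + d * y + k)
    simpa [add_assoc] using this
  simp only [h1]
  rw [← Finset.sum_div, sum_range_mul_coprime hc hcd hper]
  simp only [Int.cast_natCast]
  rw [sum_periodicBernoulliTwo_distribution hc, div_div]

lemma dedekindRademacherSum_reciprocity {c d : ℕ} (hc : 0 < c) (hd : 0 < d)
    (hcd : IsCoprime (d : ℤ) c) {x y : ℝ}
    (hxy : ¬((∃ n : ℤ, (n : ℝ) = x) ∧ ∃ n : ℤ, (n : ℝ) = y)) :
    dedekindRademacherSum c d x y + dedekindRademacherSum d c y x =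
      sawtooth x * sawtooth y + (d / c * periodicBernoulliTwo y +
        c / d * periodicBernoulliTwo x +
        periodicBernoulliTwo (c * x + d * y) / (c * d)) / 2 := by
  have hd' : (d : ℝ) ≠ 0 := by positivity
  have hc' : (c : ℝ) ≠ 0 := by positivity
  rw [dedekindRademacherSum_eq_sum_sum c hd, dedekindRademacherSum_eq_sum_sum d hc,
    Finset.sum_comm (s := range d), ← Finset.sum_add_distrib (s := range c)]
  have key : ∀ j k : ℕ,
      sawtooth ((j + y) / c) * sawtooth ((j + y) / c + (k + x) / d) +
        sawtooth ((k + x) / d) * sawtooth ((k + x) / d + (j + y) / c) =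
      sawtooth ((j + y) / c) * sawtooth ((k + x) / d) +
        (periodicBernoulliTwo ((j + y) / c) + periodicBernoulliTwo ((k + x) / d) +
          periodicBernoulliTwo ((j + y) / c + (k + x) / d)) / 2 := fun j k => by
    refine sawtooth_mul_add fun ⟨⟨m, hm⟩, ⟨n, hn⟩⟩ => hxy ⟨⟨d * n - k, ?_⟩, ⟨c * m - j, ?_⟩⟩
    · push_cast; rw [hn]; field_simp; ring
    · push_cast; rw [hm]; field_simp; ring
  have hB : ∀ {n : ℕ} (_ : 0 < n) (z : ℝ), ∑ k ∈ range n, sawtooth ((k + z) / n) = sawtooth z :=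
    fun hn z => by simpa only [add_comm z] using sum_sawtooth_distribution hn z
  have hP : ∀ {n : ℕ} (_ : 0 < n) (z : ℝ), ∑ k ∈ range n, periodicBernoulliTwo ((k + z) / n) =
      periodicBernoulliTwo z / n :=
    fun hn z => by simpa only [add_comm z] using sum_periodicBernoulliTwo_distribution hn z
  simp only [← Finset.sum_add_distrib, key]
  simp only [Finset.sum_add_distrib, ← Finset.sum_div, ← Finset.mul_sum, ← Finset.sum_mul, hB hc,
    hB hd, hP hd, hP hc, sum_sum_periodicBernoulliTwo hc hd hcd, Finset.sum_const,
    Finset.card_range, nsmul_eq_mul]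
  field_simp

/-- The Dedekind–Rademacher cocycle of the matrix `(a, b; c, d)` at the point `(x, y)`. -/
noncomputable def dedekindCocycle (a b c d : ℤ) (x y : ℝ) : ℝ :=
  if c = 0 then -(b * d * periodicBernoulliTwo y) / 2
  else dedekindRademacherSum c.natAbs (c.sign * d) x y -
    (d / c * periodicBernoulliTwo y + a / c * periodicBernoulliTwo (c * x + d * y)) / 2

lemma dedekindCocycle_neg (a b c d : ℤ) (x y : ℝ) :
    dedekindCocycle (-a) (-b) (-c) (-d) x y = dedekindCocycle a b c d x y := by
  have h : ((-c : ℤ) : ℝ) * x + ((-d : ℤ) : ℝ) * y = -(c * x + d * y) := by push_cast; ring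
  simp only [dedekindCocycle, neg_eq_zero, Int.natAbs_neg, Int.sign_neg, h,
    periodicBernoulliTwo_neg]
  simp only [neg_mul_neg, Int.cast_neg, neg_div_neg_eq]

lemma dedekindCocycle_neg_point (a b c d : ℤ) (x y : ℝ) :
    dedekindCocycle a b c d (-x) (-y) = dedekindCocycle a b c d x y := by
  have h : (c : ℝ) * -x + d * -y = -(c * x + d * y) := by ring
  simp only [dedekindCocycle, h, periodicBernoulliTwo_neg, dedekindRademacherSum_neg]

lemma dedekindCocycle_add_intCast (a b c d : ℤ) (x y : ℝ) (m n : ℤ) :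
    dedekindCocycle a b c d (x + m) (y + n) = dedekindCocycle a b c d x y := by
  have h : (c : ℝ) * (x + m) + d * (y + n) = c * x + d * y + ((c * m + d * n : ℤ) : ℝ) := by
    push_cast; ring
  simp only [dedekindCocycle, h, periodicBernoulliTwo_add_intCast,
    dedekindRademacherSum_add_intCast]

lemma dedekindCocycle_translate {a b c d : ℤ} (h : a * d - b * c = 1) (x y : ℝ) :
    dedekindCocycle a (a + b) c (c + d) x y =
      dedekindCocycle a b c d (x + y) y - periodicBernoulliTwo y / 2 := by
  unfold dedekindCocycle
  split_ifs with hc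
  · subst hc
    have h' : (a : ℝ) * d = 1 := by exact_mod_cast (by simpa using h)
    push_cast
    linear_combination (-periodicBernoulliTwo y / 2) * h'
  · have e : c.sign * (c + d) = c.sign * d + 1 * (c.natAbs : ℤ) := by
      rw [mul_add, Int.sign_mul_self_eq_natAbs]; ring
    have hc' : (c : ℝ) ≠ 0 := by exact_mod_cast hc
    have e' : (c : ℝ) * (x + y) + d * y = c * x + (c + d) * y := by ring
    rw [e, dedekindRademacherSum_add, e']
    push_cast
    rw [one_mul]
    field_simp
    ring

lemma dedekindCocycle_rotate_of_pos {a b c d : ℤ} (h : a * d - b * c = 1) (hc : 0 < c)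
    (hd : 0 < d) {x y : ℝ} (hxy : ¬((∃ n : ℤ, (n : ℝ) = x) ∧ ∃ n : ℤ, (n : ℝ) = y)) :
    dedekindCocycle b (-a) d (-c) x y =
      dedekindCocycle a b c d (-y) x + sawtooth x * sawtooth y := by
  lift c to ℕ using hc.le
  lift d to ℕ using hd.le
  have hc' : (c : ℝ) ≠ 0 := by exact_mod_cast hc.ne'
  have hd' : (d : ℝ) ≠ 0 := by exact_mod_cast hd.ne'
  have hcd : IsCoprime (d : ℤ) c := ⟨a, -b, by linear_combination h⟩
  have hxy' : ¬((∃ n : ℤ, (n : ℝ) = -y) ∧ ∃ n : ℤ, (n : ℝ) = x) := fun ⟨⟨n, hn⟩, hx⟩ =>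
    hxy ⟨hx, -n, by push_cast; linarith⟩
  have hr := dedekindRademacherSum_reciprocity (by exact_mod_cast hc) (by exact_mod_cast hd)
    hcd hxy'
  have h2 : dedekindRademacherSum d (-c) x y = -dedekindRademacherSum d c x (-y) := by
    rw [← dedekindRademacherSum_neg_right, neg_neg]
  have e : (d : ℝ) * x + -c * y = c * -y + d * x := by ring
  have hdet : (a : ℝ) * d - b * c = 1 := by exact_mod_cast h
  simp only [dedekindCocycle, hc.ne', hd.ne', if_false, Int.sign_eq_one_of_pos hc,
    Int.sign_eq_one_of_pos hd, one_mul, Int.natAbs_natCast, Int.cast_natCast, Int.cast_neg, h2, e]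
  rw [periodicBernoulliTwo_neg, sawtooth_neg] at hr
  generalize periodicBernoulliTwo (c * -y + d * x) = P at *
  have hP : a / c * P - b / d * P = P / (c * d) := by
    field_simp; linear_combination P * hdet
  linear_combination -hr + hP / 2

lemma dedekindCocycle_rotate_of_nonneg {a b c d : ℤ} (h : a * d - b * c = 1) (hc : 0 ≤ c)
    {x y : ℝ} (hxy : ¬((∃ n : ℤ, (n : ℝ) = x) ∧ ∃ n : ℤ, (n : ℝ) = y)) :
    dedekindCocycle b (-a) d (-c) x y =
      dedekindCocycle a b c d (-y) x + sawtooth x * sawtooth y := by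
  rcases hc.eq_or_lt with rfl | hc
  · have had : a * d = 1 := by linarith
    rcases Int.eq_one_or_neg_one_of_mul_eq_one' had with ⟨rfl, rfl⟩ | ⟨rfl, rfl⟩ <;>
    · simp [dedekindCocycle, dedekindRademacherSum_one_zero, periodicBernoulliTwo_neg]
      ring
  rcases lt_trichotomy d 0 with hd | rfl | hd
  · have hxy' : ¬((∃ n : ℤ, (n : ℝ) = -y) ∧ ∃ n : ℤ, (n : ℝ) = x) := fun ⟨⟨n, hn⟩, hx⟩ =>
      hxy ⟨hx, -n, by push_cast; linarith⟩
    have := dedekindCocycle_rotate_of_pos (a := -b) (b := a) (c := -d) (d := c) (by linarith)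
      (by linarith) hc hxy'
    rw [neg_neg, neg_neg, dedekindCocycle_neg_point, sawtooth_neg] at this
    have e := dedekindCocycle_neg b (-a) d (-c) x y
    rw [neg_neg, neg_neg] at e
    linarith
  · have hbc : b * c = -1 := by linarith
    have : c = 1 := by
      have : IsUnit c := IsUnit.of_mul_eq_one (-b) (by linarith)
      rcases Int.isUnit_iff.1 this with h | h <;> omega
    subst this
    simp [dedekindCocycle, dedekindRademacherSum_one_zero, sawtooth_neg, periodicBernoulliTwo_neg]
    ring
  · exact dedekindCocycle_rotate_of_pos h hc hd hxy

lemma dedekindCocycle_rotate {a b c d : ℤ} (h : a * d - b * c = 1)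
    {x y : ℝ} (hxy : ¬((∃ n : ℤ, (n : ℝ) = x) ∧ ∃ n : ℤ, (n : ℝ) = y)) :
    dedekindCocycle b (-a) d (-c) x y =
      dedekindCocycle a b c d (-y) x + sawtooth x * sawtooth y := by
  rcases le_total 0 c with hc | hc
  · exact dedekindCocycle_rotate_of_nonneg h hc hxy
  · have := dedekindCocycle_rotate_of_nonneg (a := -a) (b := -b) (c := -c) (d := -d)
      (by linarith) (by linarith) hxy
    rwa [dedekindCocycle_neg, dedekindCocycle_neg] at this

/-- The Dedekind–Rademacher cocycle on `SL₂(ℤ)`. -/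
noncomputable def dedekindCocycleSL (g : Matrix.SpecialLinearGroup (Fin 2) ℤ) (x y : ℝ) : ℝ :=
  dedekindCocycle (g 0 0) (g 0 1) (g 1 0) (g 1 1) x y

lemma not_int_smul (g : Matrix.SpecialLinearGroup (Fin 2) ℤ) {x y : ℝ}
    (hxy : ¬((∃ n : ℤ, (n : ℝ) = x) ∧ ∃ n : ℤ, (n : ℝ) = y)) :
    ¬((∃ n : ℤ, (n : ℝ) = g 0 0 * x + g 0 1 * y) ∧ ∃ n : ℤ, (n : ℝ) = g 1 0 * x + g 1 1 * y) := by
  rintro ⟨⟨m, hm⟩, n, hn⟩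
  have hdet : (g 0 0 : ℝ) * g 1 1 - g 0 1 * g 1 0 = 1 := by
    exact_mod_cast (Matrix.det_fin_two g.1).symm.trans g.2
  refine hxy ⟨⟨g 1 1 * m - g 0 1 * n, ?_⟩, ⟨g 0 0 * n - g 1 0 * m, ?_⟩⟩
  · push_cast
    rw [hm, hn]
    linear_combination x * hdet
  · push_cast
    rw [hm, hn]
    linear_combination y * hdet

lemma dedekindCocycleSL_one (x y : ℝ) : dedekindCocycleSL 1 x y = 0 := by
  simp [dedekindCocycleSL, dedekindCocycle]

lemma dedekindCocycleSL_mul (g h : Matrix.SpecialLinearGroup (Fin 2) ℤ) {x y : ℝ}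
    (hxy : ¬((∃ n : ℤ, (n : ℝ) = x) ∧ ∃ n : ℤ, (n : ℝ) = y)) :
    dedekindCocycleSL (g * h) x y =
      dedekindCocycleSL g (h 0 0 * x + h 0 1 * y) (h 1 0 * x + h 1 1 * y) +
        dedekindCocycleSL h x y := by
  have hmem : h ∈ Subgroup.closure {ModularGroup.S, ModularGroup.T} := by
    simp [SpecialLinearGroup.SL2Z_generators]
  have hmul : ∀ h k : Matrix.SpecialLinearGroup (Fin 2) ℤ, ∀ i j, (h * k) i j =
      h i 0 * k 0 j + h i 1 * k 1 j := fun h k i j => by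
    simp [Matrix.mul_apply, Fin.sum_univ_two]
  induction hmem using Subgroup.closure_induction generalizing g x y with
  | mem k hk =>
    have hdet := (Matrix.det_fin_two g.1).symm.trans g.2
    rcases hk with rfl | rfl
    · have := dedekindCocycle_rotate hdet hxy
      simp only [dedekindCocycleSL, hmul]
      simp [ModularGroup.S]
      rw [this]
      simp [dedekindCocycle, dedekindRademacherSum_one_zero, mul_comm]
    · have := dedekindCocycle_translate hdet x y
      simp only [dedekindCocycleSL, hmul]
      simp [ModularGroup.T]
      rw [this]
      simp [dedekindCocycle]
      ring
  | one => simp [dedekindCocycleSL_one]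
  | mul h k _ _ ih ik =>
    rw [← mul_assoc, ik _ hxy, ih _ (not_int_smul k hxy), ik _ hxy, ← add_assoc]
    simp only [hmul]
    push_cast
    congr 3 <;> ring
  | inv h _ ih =>
    have hxy' := not_int_smul h⁻¹ hxy
    have hdet : ((h⁻¹ 0 0 : ℤ) : ℝ) * h⁻¹ 1 1 - h⁻¹ 0 1 * h⁻¹ 1 0 = 1 := by
      exact_mod_cast (Matrix.det_fin_two h⁻¹.1).symm.trans h⁻¹.2
    have hi : h 0 0 = h⁻¹ 1 1 ∧ h 0 1 = -h⁻¹ 0 1 ∧ h 1 0 = -h⁻¹ 1 0 ∧ h 1 1 = h⁻¹ 0 0 := by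
      simp [Matrix.SpecialLinearGroup.coe_inv, Matrix.adjugate_fin_two]
    have e : ∀ g : Matrix.SpecialLinearGroup (Fin 2) ℤ, dedekindCocycleSL g
        (h⁻¹ 0 0 * x + h⁻¹ 0 1 * y) (h⁻¹ 1 0 * x + h⁻¹ 1 1 * y) =
        dedekindCocycleSL (g * h⁻¹) x y + dedekindCocycleSL h
          (h⁻¹ 0 0 * x + h⁻¹ 0 1 * y) (h⁻¹ 1 0 * x + h⁻¹ 1 1 * y) := fun g => by
      have := ih (g * h⁻¹) hxy'
      rw [inv_mul_cancel_right] at this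
      rw [this]
      congr 2
      · rw [hi.1, hi.2.1]
        push_cast
        linear_combination x * hdet
      · rw [hi.2.2.1, hi.2.2.2]
        push_cast
        linear_combination y * hdet
    have e1 := e 1
    rw [one_mul, dedekindCocycleSL_one] at e1
    linarith [e g]

lemma sum_conj_character_range {q : ℕ} (hq : 0 < q) {χ : DirichletCharacter ℂ q} (hχ : χ ≠ 1) :
    ∑ n ∈ range q, (starRingEnd ℂ) (χ (n : ZMod q)) = 0 := by
  have : NeZero q := ⟨hq.ne'⟩
  rw [← map_sum, ← map_zero (starRingEnd ℂ), ← MulChar.sum_eq_zero_of_ne_one hχ]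
  congr 1
  exact Finset.sum_bij' (fun k _ => (k : ZMod q)) (fun z _ => z.val) (by simp)
    (fun z _ => Finset.mem_range.2 z.val_lt)
    (fun k hk => ZMod.val_cast_of_lt (Finset.mem_range.1 hk)) (by simp) (fun _ _ => rfl)

lemma sum_range_mul_eq_sum_sum {M : Type*} [AddCommMonoid M] (f : ℕ → M) (q c : ℕ) :
    ∑ j ∈ range (q * c), f j = ∑ m ∈ range q, ∑ k ∈ range c, f (q * k + m) := by
  rw [Finset.sum_comm]
  induction c with
  | zero => simp
  | succ c ih => rw [mul_add, mul_one, Finset.sum_range_add, ih, Finset.sum_range_succ]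

lemma newformDedekindSum_eq {q₁ q₂ : ℕ} (hq₂ : 0 < q₂) (χ₁ : DirichletCharacter ℂ q₁)
    (χ₂ : DirichletCharacter ℂ q₂) (a : ℤ) {c : ℕ} (hc : 0 < c) :
    newformDedekindSum χ₁ χ₂ a (q₂ * c : ℕ) = ∑ m ∈ range q₂, ∑ n ∈ range q₁,
      (starRingEnd ℂ) (χ₂ (m : ZMod q₂)) * (starRingEnd ℂ) (χ₁ (n : ZMod q₁)) *
        (dedekindRademacherSum c a (n / q₁) (m / q₂) : ℂ) := by
  have hq : (q₂ : ℝ) ≠ 0 := by positivity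
  have hc' : (c : ℝ) ≠ 0 := by positivity
  unfold newformDedekindSum dedekindRademacherSum
  rw [Int.toNat_natCast, sum_range_mul_eq_sum_sum]
  refine Finset.sum_congr rfl fun m _ => ?_
  rw [Finset.sum_comm]
  refine Finset.sum_congr rfl fun n _ => ?_
  push_cast
  rw [Finset.mul_sum]
  refine Finset.sum_congr rfl fun k _ => ?_
  have e : ((q₂ : ℝ) * k + m) / (q₂ * c) = (k + m / q₂) / c := by field_simp
  rw [mul_div_assoc, e, mul_assoc, mul_assoc]
  simp [mul_assoc]

lemma newformDedekindSumSL_eq {q₁ q₂ : ℕ} (hq₁ : 0 < q₁) (hq₂ : 0 < q₂)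
    {χ₁ : DirichletCharacter ℂ q₁} (χ₂ : DirichletCharacter ℂ q₂) (hχ₁ : χ₁ ≠ 1)
    {γ g : Matrix.SpecialLinearGroup (Fin 2) ℤ} (h10 : γ 1 0 = g 1 0 * q₂) (h11 : γ 0 0 = g 1 1)
    (hγ10 : (q₁ : ℤ) ∣ g 1 0) (hγ11 : (q₂ : ℤ) ∣ g 1 1 - 1) :
    newformDedekindSumSL χ₁ χ₂ γ = ∑ m ∈ range q₂, ∑ n ∈ range q₁,
      (starRingEnd ℂ) (χ₂ (m : ZMod q₂)) * (starRingEnd ℂ) (χ₁ (n : ZMod q₁)) *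
        (dedekindCocycleSL g (n / q₁) (m / q₂) : ℂ) := by
  have hq₂' : (q₂ : ℝ) ≠ 0 := by positivity
  have hq₁' : (q₁ : ℝ) ≠ 0 := by positivity
  have hvanish : ∀ F : ℕ → ℂ, ∑ m ∈ range q₂, ∑ n ∈ range q₁,
      (starRingEnd ℂ) (χ₂ (m : ZMod q₂)) * (starRingEnd ℂ) (χ₁ (n : ZMod q₁)) * F m = 0 :=
    fun F => Finset.sum_eq_zero fun m _ => by
      rw [← Finset.sum_mul, ← Finset.mul_sum, sum_conj_character_range hq₁ hχ₁]
      simp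
  by_cases hc : g 1 0 = 0
  · rw [newformDedekindSumSL, if_pos (by rw [h10, hc, zero_mul])]
    simp only [dedekindCocycleSL, dedekindCocycle, if_pos hc]
    exact (hvanish fun m =>
      ((-(g 0 1 * g 1 1 * periodicBernoulliTwo (m / q₂)) / 2 : ℝ) : ℂ)).symm
  have hB : ∀ m n : ℕ, periodicBernoulliTwo (g 1 0 * (n / q₁) + g 1 1 * (m / q₂)) =
      periodicBernoulliTwo (m / q₂) := fun m n => by
    obtain ⟨r, hr⟩ := hγ10
    obtain ⟨s, hs⟩ := hγ11
    have hs' : g 1 1 = q₂ * s + 1 := by linarith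
    rw [← periodicBernoulliTwo_add_intCast (m / q₂) (r * n + s * m), hr, hs']
    congr 1
    push_cast
    field_simp
    ring
  have hmain : newformDedekindSumSL χ₁ χ₂ γ = ∑ m ∈ range q₂, ∑ n ∈ range q₁,
      (starRingEnd ℂ) (χ₂ (m : ZMod q₂)) * (starRingEnd ℂ) (χ₁ (n : ZMod q₁)) *
        (dedekindRademacherSum (g 1 0).natAbs ((g 1 0).sign * g 1 1) (n / q₁) (m / q₂) : ℂ) := by
    rw [← newformDedekindSum_eq hq₂ χ₁ χ₂ _ (Int.natAbs_pos.2 hc), newformDedekindSumSL]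
    have hq₂z : (0 : ℤ) < q₂ := by exact_mod_cast hq₂
    rcases lt_or_gt_of_ne hc with hneg | hpos
    · have : g 1 0 * q₂ < 0 := mul_neg_of_neg_of_pos hneg hq₂z
      rw [if_neg (by rw [h10]; omega), if_neg (by rw [h10]; omega), h10, h11,
        Int.sign_eq_neg_one_of_neg hneg]
      congr 1
      · ring
      · push_cast
        rw [abs_of_neg hneg]; ring
    · have : 0 < g 1 0 * q₂ := mul_pos hpos hq₂z
      rw [if_neg (by rw [h10]; omega), if_pos (by rw [h10]; omega), h10, h11,
        Int.sign_eq_one_of_pos hpos]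
      congr 1
      · ring
      · push_cast
        rw [abs_of_pos hpos]; ring
  rw [hmain, ← sub_eq_zero, ← Finset.sum_sub_distrib]
  simp only [← Finset.sum_sub_distrib, ← mul_sub, dedekindCocycleSL, dedekindCocycle, if_neg hc, hB,
    ← Complex.ofReal_sub, sub_sub_cancel]
  exact hvanish fun m => ((((g 1 1 : ℝ) / g 1 0 * periodicBernoulliTwo (m / q₂) +
    g 0 0 / g 1 0 * periodicBernoulliTwo (m / q₂)) / 2 : ℝ) : ℂ)

lemma exists_dual_of_inGamma1 {q₁ q₂ : ℕ} {γ : Matrix.SpecialLinearGroup (Fin 2) ℤ}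
    (hγ : InGamma1 (q₁ * q₂) γ) : ∃ g : Matrix.SpecialLinearGroup (Fin 2) ℤ,
      g 0 0 = γ 1 1 ∧ g 0 1 = γ 0 1 * q₂ ∧ γ 1 0 = g 1 0 * q₂ ∧ γ 0 0 = g 1 1 ∧
      (q₁ : ℤ) ∣ g 1 0 ∧ (q₂ : ℤ) ∣ g 1 1 - 1 ∧ (q₁ : ℤ) ∣ g 0 0 - 1 := by
  obtain ⟨⟨r, hr⟩, ha, hd⟩ := hγ
  have hdet := (Matrix.det_fin_two γ.1).symm.trans γ.2
  push_cast at hr ha hd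
  refine ⟨⟨!![γ 1 1, γ 0 1 * q₂; q₁ * r, γ 0 0], ?_⟩, rfl, rfl, ?_, rfl, dvd_mul_right _ _,
    (dvd_mul_left _ _).trans ha, (dvd_mul_right _ _).trans hd⟩
  · rw [hr] at hdet
    rw [Matrix.det_fin_two_of]
    linear_combination hdet
  · change γ 1 0 = q₁ * r * q₂
    linear_combination hr

theorem newform_dedekind_sum_homomorphism {q₁ q₂ : ℕ} (hq₁ : 0 < q₁) (hq₂ : 0 < q₂)
    (χ₁ : DirichletCharacter ℂ q₁) (χ₂ : DirichletCharacter ℂ q₂)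
    (hχ₁ : χ₁ ≠ 1) (hχ₂ : χ₂ ≠ 1) (hp₁ : χ₁.IsPrimitive) (hp₂ : χ₂.IsPrimitive)
    (hpar : χ₁ (-1) * χ₂ (-1) = 1)
    (γ₁ γ₂ : Matrix.SpecialLinearGroup (Fin 2) ℤ)
    (hγ₁ : InGamma1 (q₁ * q₂) γ₁) (hγ₂ : InGamma1 (q₁ * q₂) γ₂) :
    newformDedekindSumSL χ₁ χ₂ (γ₁ * γ₂) =
      newformDedekindSumSL χ₁ χ₂ γ₁ + newformDedekindSumSL χ₁ χ₂ γ₂ := by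
  have hq₂' : (q₂ : ℝ) ≠ 0 := by positivity
  have hq₁' : (q₁ : ℝ) ≠ 0 := by positivity
  obtain ⟨g₁, h00, h01, h10, h11, hc, ha, hd⟩ := exists_dual_of_inGamma1 hγ₁
  obtain ⟨g₂, -, -, k10, k11, kc, ka, -⟩ := exists_dual_of_inGamma1 hγ₂
  have hmul : ∀ h k : Matrix.SpecialLinearGroup (Fin 2) ℤ, ∀ i j, (h * k) i j =
      h i 0 * k 0 j + h i 1 * k 1 j := fun h k i j => by
    simp [Matrix.mul_apply, Fin.sum_univ_two]
  have hg10 : (γ₁ * γ₂) 1 0 = (g₂ * g₁) 1 0 * q₂ := by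
    rw [hmul, hmul, h10, k10, h00, k11]; ring
  have hg11 : (γ₁ * γ₂) 0 0 = (g₂ * g₁) 1 1 := by
    rw [hmul, hmul, k10, h11, k11, h01]; ring
  have hgc : (q₁ : ℤ) ∣ (g₂ * g₁) 1 0 := by
    rw [hmul]; exact dvd_add (kc.mul_right _) (hc.mul_left _)
  have hga : (q₂ : ℤ) ∣ (g₂ * g₁) 1 1 - 1 := by
    have e : (g₂ * g₁) 1 1 - 1 =
        g₂ 1 0 * (γ₁ 0 1 * q₂) + (g₂ 1 1 * (g₁ 1 1 - 1) + (g₂ 1 1 - 1)) := by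
      rw [hmul, h01]; ring
    rw [e]
    exact dvd_add ((dvd_mul_left _ _).mul_left _) (dvd_add (ha.mul_left _) ka)
  rw [newformDedekindSumSL_eq hq₁ hq₂ χ₂ hχ₁ hg10 hg11 hgc hga,
    newformDedekindSumSL_eq hq₁ hq₂ χ₂ hχ₁ h10 h11 hc ha,
    newformDedekindSumSL_eq hq₁ hq₂ χ₂ hχ₁ k10 k11 kc ka, ← Finset.sum_add_distrib]
  refine Finset.sum_congr rfl fun m hm => ?_
  rw [← Finset.sum_add_distrib]
  refine Finset.sum_congr rfl fun n _ => ?_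
  rcases Nat.eq_zero_or_pos m with rfl | hm0
  · have : Nontrivial (ZMod q₂) := by
      refine not_subsingleton_iff_nontrivial.1 fun hs => hχ₂ ?_
      ext u
      rw [Subsingleton.elim u 1]; simp
    simp [MulChar.map_zero]
  have hxy : ¬((∃ k : ℤ, (k : ℝ) = n / q₁) ∧ ∃ k : ℤ, (k : ℝ) = m / q₂) := by
    rintro ⟨-, k, hk⟩
    rw [eq_div_iff hq₂'] at hk
    have hk' : k * q₂ = m := by exact_mod_cast hk
    have hmlt := Finset.mem_range.1 hm
    exact absurd (Int.le_of_dvd (by omega) (Dvd.intro_left k hk')) (by omega)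
  have hfix : dedekindCocycleSL g₂ (g₁ 0 0 * (n / q₁) + g₁ 0 1 * (m / q₂))
      (g₁ 1 0 * (n / q₁) + g₁ 1 1 * (m / q₂)) = dedekindCocycleSL g₂ (n / q₁) (m / q₂) := by
    obtain ⟨r, hr⟩ := hc
    obtain ⟨s, hs⟩ := ha
    obtain ⟨t, ht⟩ := hd
    have hs' : g₁ 1 1 = q₂ * s + 1 := by linarith
    have ht' : g₁ 0 0 = q₁ * t + 1 := by linarith
    unfold dedekindCocycleSL
    rw [← dedekindCocycle_add_intCast (x := n / q₁) (y := m / q₂) (m := t * n + γ₁ 0 1 * m)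
      (n := r * n + s * m), hr, hs', ht', h01]
    congr 1
    · push_cast
      field_simp
      ring
    · push_cast
      field_simp
      ring
  rw [dedekindCocycleSL_mul g₂ g₁ hxy, hfix]
  push_cast
  ring
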